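/- Let 𝒴 be a GH-precompact family of nonempty compact metric spaces and let ε, ε' > 0. If X is a nonempty finite metric space such that Y ≺_ε X for every Y ∈ 𝒴, then there exists a nonempty finite metric space X' with d_GH(X, X') < 6ε such that Y ≺_{ε'} X' for every Y ∈ 𝒴. -/

import Mathlib

open GromovHausdorff Metric

/-- Two compact metric spaces at Gromov–Hausdorff distance less than `δ` are related by a map of
distortion at most `2δ` with `2δ`-dense image. -/
theorem exists_approx_map_of_ghDist_lt {A B : Type*} [MetricSpace A] [CompactSpace A] [Nonempty A]
    [MetricSpace B] [CompactSpace B] [Nonempty B] {δ : ℝ} (h : ghDist A B < δ) :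
    ∃ g : A → B, (∀ a a', dist (g a) (g a') ≤ dist a a' + 2 * δ) ∧
      ∀ b, ∃ a, dist b (g a) ≤ 2 * δ := by
  obtain ⟨Φ, Ψ, hΦ, hΨ, heq⟩ := ghDist_eq_hausdorffDist A B
  rw [heq] at h
  have hfin : hausdorffEDist (Set.range Φ) (Set.range Ψ) ≠ ⊤ :=
    hausdorffEDist_ne_top_of_nonempty_of_bounded (Set.range_nonempty _) (Set.range_nonempty _)
      (isCompact_range hΦ.continuous).isBounded (isCompact_range hΨ.continuous).isBounded
  have hA : ∀ a, ∃ b, dist (Φ a) (Ψ b) < δ := fun a => by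
    obtain ⟨_, ⟨b, rfl⟩, hb⟩ := exists_dist_lt_of_hausdorffDist_lt (Set.mem_range_self a) h hfin
    exact ⟨b, hb⟩
  choose g hg using hA
  refine ⟨g, fun a a' => ?_, fun b => ?_⟩
  · rw [← hΨ.dist_eq, ← hΦ.dist_eq]
    have := dist_triangle4_left (Φ a) (Φ a') (Ψ (g a)) (Ψ (g a'))
    have := hg a
    have := hg a'
    linarith
  · obtain ⟨_, ⟨a, rfl⟩, ha⟩ := exists_dist_lt_of_hausdorffDist_lt' (Set.mem_range_self b) h hfin
    refine ⟨a, ?_⟩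
    rw [← hΨ.dist_eq]
    have := dist_triangle_left (Ψ b) (Ψ (g a)) (Φ a)
    have := hg a
    linarith

/-- If a finite space `X` carries maps to finitely many compact spaces `Z k` which are `ε`-dense and
expand distances by at most `ε`, then some finite space `3ε/2`-close to `X` carries
distance-nonincreasing maps to all `Z k` with `η`-dense images. -/
theorem exists_finite_metricSpace_ghDist_le {κ X : Type*} [Fintype κ] (Z : κ → Type*)
    [∀ k, MetricSpace (Z k)] [∀ k, CompactSpace (Z k)]
    [MetricSpace X] [Fintype X] [Nonempty X] {ε η : ℝ} (hε : 0 ≤ ε) (hη : 0 < η)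
    (f : ∀ k, X → Z k) (hf : ∀ k x x', dist (f k x) (f k x') ≤ dist x x' + ε)
    (hd : ∀ k z, ∃ x, dist z (f k x) ≤ ε) :
    ∃ (X' : Type) (_ : MetricSpace X') (_ : Fintype X') (_ : Nonempty X'),
      ghDist X X' ≤ 3 / 2 * ε ∧
      ∀ k, ∃ p : X' → Z k, (∀ x x', dist (p x) (p x') ≤ dist x x') ∧
        ∀ z, ∃ x, dist z (p x) ≤ η := by
  classical
  have hnet : ∀ k, ∃ N : Set (Z k), N.Finite ∧ Set.range (f k) ⊆ N ∧
      ∀ z, ∃ w ∈ N, dist z w ≤ η := fun k => by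
    obtain ⟨t, -, ht, hc⟩ := finite_cover_balls_of_compact (isCompact_univ (X := Z k)) hη
    refine ⟨t ∪ Set.range (f k), ht.union (Set.finite_range _), Set.subset_union_right,
      fun z => ?_⟩
    obtain ⟨w, hw, hzw⟩ := Set.mem_iUnion₂.1 (hc (Set.mem_univ z))
    exact ⟨w, Or.inl hw, (mem_ball.1 hzw).le⟩
  choose N hNfin hfN hN using hnet
  let S : Set (X × ∀ k, Z k) := {q | ∀ k, q.2 k ∈ N k ∧ dist (q.2 k) (f k q.1) ≤ ε}
  have hSfin : S.Finite :=
    (Set.finite_univ.prod (Set.Finite.pi' hNfin)).subset fun q hq =>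
      ⟨Set.mem_univ _, fun k => (hq k).1⟩
  let Φ : X → S := fun x => ⟨(x, fun k => f k x), fun k =>
    ⟨hfN k (Set.mem_range_self x), by simpa using hε⟩⟩
  have : Fintype S := hSfin.fintype
  have : Nonempty S := Nonempty.map Φ inferInstance
  let e : Fin (Fintype.card S) ≃ S := (Fintype.equivFin S).symm
  let : MetricSpace (Fin (Fintype.card S)) := MetricSpace.induced e e.injective inferInstance
  have hdist : ∀ i j, dist i j = dist (e i) (e j) := fun _ _ => rfl
  refine ⟨Fin (Fintype.card S), inferInstance, inferInstance, e.nonempty, ?_, fun k =>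
    ⟨fun i => (e i).1.2 k, fun i j => ?_, fun z => ?_⟩⟩
  · have : Nonempty (Fin (Fintype.card S)) := e.nonempty
    have := ghDist_le_of_approx_subsets (s := (Set.univ : Set X))
      (Y := Fin (Fintype.card S)) (fun x => e.symm (Φ x)) (ε₁ := 0) (ε₂ := ε) (ε₃ := ε)
      (fun x => ⟨x, Set.mem_univ _, by simp⟩)
      (fun i => ⟨⟨(e i).1.1, Set.mem_univ _⟩, ?_⟩) (fun x y => ?_)
    · linarith
    · rw [hdist, Equiv.apply_symm_apply, Subtype.dist_eq, Prod.dist_eq]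
      exact max_le (by simpa [Φ] using hε) ((dist_pi_le_iff hε).2 fun k => ((e i).2 k).2)
    · rw [hdist, Equiv.apply_symm_apply, Equiv.apply_symm_apply, Subtype.dist_eq,
        Subtype.dist_eq, abs_le, Prod.dist_eq]
      have h1 : dist (x : X) y ≤ max (dist (x : X) y)
        (dist (fun k => f k x) (fun k => f k y)) := le_max_left _ _
      have h2 : max (dist (x : X) y) (dist (fun k => f k x) (fun k => f k y)) ≤
          dist (x : X) y + ε :=
        max_le (by linarith) ((dist_pi_le_iff (by positivity)).2 fun k => hf k x y)
      simp only [Φ]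
      constructor <;> linarith
  · rw [hdist, Subtype.dist_eq, Prod.dist_eq]
    exact (dist_le_pi_dist _ _ k).trans (le_max_right _ _)
  · obtain ⟨w, hw, hzw⟩ := hN k z
    obtain ⟨x, hx⟩ := hd k w
    refine ⟨e.symm ⟨(x, Function.update (fun j => f j x) k w), fun j => ?_⟩, by simpa using hzw⟩
    obtain rfl | hj := eq_or_ne j k
    · simpa using ⟨hw, hx⟩
    · simpa [hj] using ⟨hfN j (Set.mem_range_self x), hε⟩

/-- If `𝒴` is a GH-precompact family of nonempty compact metric spaces,
`ε, ε' > 0`, and `X` is a nonempty finite metric space with `Y ≺_ε X` for every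
`Y ∈ 𝒴`, then there is a nonempty finite metric space `X'` with
`d_GH(X, X') < 6ε` and `Y ≺_{ε'} X'` for every `Y ∈ 𝒴`. -/
theorem stmt5 {ι : Type*} (Y : ι → Type*) [∀ i, MetricSpace (Y i)]
    [∀ i, CompactSpace (Y i)] [∀ i, Nonempty (Y i)]
    (hYpc : TotallyBounded (Set.range fun i => toGHSpace (Y i)))
    (ε ε' : ℝ) (hε : 0 < ε) (hε' : 0 < ε')
    (X : Type*) [MetricSpace X] [Fintype X] [Nonempty X]
    (hX : ∀ i, ∃ f : X → Y i,
      (∀ x x' : X, dist (f x) (f x') ≤ dist x x' + ε) ∧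
      ∀ y : Y i, infDist y (Set.range f) ≤ ε) :
    ∃ (X' : Type) (_ : MetricSpace X') (_ : Fintype X') (_ : Nonempty X'),
      ghDist X X' < 6 * ε ∧
      ∀ i, ∃ f : X' → Y i,
        (∀ x x' : X', dist (f x) (f x') ≤ dist x x' + ε') ∧
        ∀ y : Y i, infDist y (Set.range f) ≤ ε' := by
  have hδ : 0 < ε' / 8 := by positivity
  obtain ⟨t, ht, htfin, hcov⟩ := totallyBounded_iff_subset.1 hYpc _ (dist_mem_uniformity hδ)
  obtain ⟨T, hTfin, rfl⟩ : ∃ T : Set ι, T.Finite ∧ (fun i => toGHSpace (Y i)) '' T = t := by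
    have := htfin.to_subtype
    choose s hs using fun a : t => ht a.2
    refine ⟨Set.range s, Set.finite_range s, ?_⟩
    rw [← Set.range_comp]
    exact (congrArg Set.range (funext hs)).trans Subtype.range_coe
  have hnear : ∀ i, ∃ k : T, ghDist (Y k) (Y i) < ε' / 8 := fun i => by
    obtain ⟨_, ⟨k, hk, rfl⟩, hik⟩ := Set.mem_iUnion₂.1 (hcov (Set.mem_range_self i))
    refine ⟨⟨k, hk⟩, ?_⟩
    rw [ghDist, dist_comm]
    exact hik
  have : Fintype T := hTfin.fintype
  choose f hf hd using hX
  have hd' : ∀ i y, ∃ x, dist y (f i x) ≤ ε := fun i y => by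
    obtain ⟨_, ⟨x, rfl⟩, hx⟩ := (Set.finite_range (f i)).isCompact.exists_infDist_eq_dist
      (Set.range_nonempty _) y
    exact ⟨x, hx ▸ hd i y⟩
  obtain ⟨X', _, _, _, hXX', hp⟩ := exists_finite_metricSpace_ghDist_le (fun k : T => Y k) hε.le
    (half_pos hε') (fun k => f k) (fun k => hf k) (fun k => hd' k)
  refine ⟨X', inferInstance, inferInstance, inferInstance, by linarith, fun i => ?_⟩
  obtain ⟨k, hk⟩ := hnear i
  obtain ⟨g, hg, hgd⟩ := exists_approx_map_of_ghDist_lt hk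
  obtain ⟨p, hp, hpd⟩ := hp k
  refine ⟨g ∘ p, fun x x' => ?_, fun y => ?_⟩
  · have := hg (p x) (p x')
    have := hp x x'
    simp only [Function.comp_apply]
    linarith
  · obtain ⟨a, ha⟩ := hgd y
    obtain ⟨x, hx⟩ := hpd a
    refine (infDist_le_dist_of_mem (Set.mem_range_self x)).trans ?_
    have := dist_triangle y (g a) (g (p x))
    have := hg a (p x)
    simp only [Function.comp_apply]
    linarith
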